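/- Let n, k be positive integers with k ≤ n, let S, T ⊆ {1,…,n} with |S| = |T| = k, and suppose |S ∩ T| = βk for some real β with 0 ≤ β ≤ 0.9. Let v be a random vector in ℝ^n with i.i.d. standard Gaussian N(0,1) entries, and let d > 0. Then P[ |Σ_{i∈S} v_i| ≤ d and |Σ_{i∈T} v_i| ≤ d ] ≤ (2/π)·d² / (k(1 − β)). -/

import Mathlib

open MeasureTheory ProbabilityTheory
open scoped NNReal ENNReal

/-- The sign function: `1` if `0 ≤ z`, `-1` otherwise. -/
noncomputable def sgn (z : ℝ) : ℝ := if 0 ≤ z then 1 else -1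

/-- `X_k(R)`: vectors in `ℝ^n` with at most `k` nonzero entries whose nonzero
entries have magnitude ratio at most `R`. -/
def sparseDR (n k : ℕ) (R : ℝ) : Set (Fin n → ℝ) :=
  {x | (Finset.univ.filter fun i => x i ≠ 0).card ≤ k ∧
       ∀ i j : Fin n, x i ≠ 0 → x j ≠ 0 → |x i| ≤ R * |x j|}

/-- `A` is a valid universal 1-bit measurement matrix for support recovery on `X_k(R)`. -/
def ValidMeas (m n k : ℕ) (R : ℝ) (A : Fin m → Fin n → ℝ) : Prop :=
  ∀ u ∈ sparseDR n k R, ∀ v ∈ sparseDR n k R,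
    Function.support u ≠ Function.support v →
      (fun i => sgn (∑ j, A i j * u j)) ≠ (fun i => sgn (∑ j, A i j * v j))

/-- `V ⊆ ℝ^n` is `(n, ℓ, d)`-balanced. -/
def IsBalanced (n ℓ : ℕ) (d : ℝ) (V : Set (Fin n → ℝ)) : Prop :=
  ∀ S : Finset (Fin n), S.card = ℓ → ∃ v ∈ V, |∑ i ∈ S, v i| ≤ d

/-- Law of a random vector in `ℝ^n` with i.i.d. standard Gaussian entries. -/
noncomputable def gaussVec (n : ℕ) : Measure (Fin n → ℝ) :=
  Measure.pi fun _ => gaussianReal 0 1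

/-- Law of `m` independent random vectors in `ℝ^n` with i.i.d. standard Gaussian entries
(equivalently, an `m × n` random matrix with i.i.d. `N(0,1)` entries). -/
noncomputable def gaussMat (m n : ℕ) : Measure (Fin m → Fin n → ℝ) :=
  Measure.pi fun _ => gaussVec n

/-- The event `F_U`: every one of the `m` vectors `v j` satisfies `|∑_{i ∈ U} (v j) i| > d`. -/
def FEvent (m n : ℕ) (d : ℝ) (U : Finset (Fin n)) : Set (Fin m → Fin n → ℝ) :=
  {v | ∀ j : Fin m, d < |∑ i ∈ U, v j i|}

/-- A Gaussian of variance `v` has density at most `1 / √(2πv)`, which bounds the mass it gives to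
an interval of length `2d`. -/
lemma gaussianReal_setOf_abs_add_le (μ : ℝ) {v : ℝ≥0} (hv : v ≠ 0) (c d : ℝ) :
    gaussianReal μ v {x | |x + c| ≤ d} ≤ ENNReal.ofReal ((√(2 * Real.pi * v))⁻¹ * (2 * d)) := by
  have hset : {x : ℝ | |x + c| ≤ d} = Set.Icc (-d - c) (d - c) := by
    ext x
    simp only [Set.mem_ofPred_eq, Set.mem_Icc, abs_le]
    constructor <;> rintro ⟨h₁, h₂⟩ <;> constructor <;> linarith
  have hpdf (x : ℝ) : gaussianPDF μ v x ≤ ENNReal.ofReal (√(2 * Real.pi * v))⁻¹ := by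
    rw [gaussianPDF_def, gaussianPDFReal_def]
    refine ENNReal.ofReal_le_ofReal (mul_le_of_le_one_right (by positivity) ?_)
    exact Real.exp_le_one_iff.2 (div_nonpos_of_nonpos_of_nonneg (by nlinarith [sq_nonneg (x - μ)])
      (by positivity))
  rw [hset, gaussianReal_apply μ hv]
  calc ∫⁻ x in Set.Icc (-d - c) (d - c), gaussianPDF μ v x
      ≤ ∫⁻ _ in Set.Icc (-d - c) (d - c), ENNReal.ofReal (√(2 * Real.pi * v))⁻¹ :=
        lintegral_mono hpdf
    _ = ENNReal.ofReal ((√(2 * Real.pi * v))⁻¹ * (2 * d)) := by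
        rw [setLIntegral_const, Real.volume_Icc, ← ENNReal.ofReal_mul (by positivity)]
        congr 2
        ring

/-- If `X` is independent of `Y` and every section of `A` has mass at most `M` under the law of
`X`, then `(X, Y) ∈ A` and `Y ∈ B` hold together with probability at most `M * P(Y ∈ B)`. -/
lemma ProbabilityTheory.IndepFun.measure_prodMk_mem_and_mem_le {Ω E F : Type*} [MeasurableSpace Ω]
    [MeasurableSpace E] [MeasurableSpace F] {P : Measure Ω} [IsProbabilityMeasure P]
    {X : Ω → E} {Y : Ω → F} (hXY : IndepFun X Y P) (hX : Measurable X) (hY : Measurable Y)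
    {A : Set (E × F)} (hA : MeasurableSet A) {B : Set F} (hB : MeasurableSet B) {M : ℝ≥0∞}
    (hM : ∀ y, P.map X {x | (x, y) ∈ A} ≤ M) :
    P {ω | (X ω, Y ω) ∈ A ∧ Y ω ∈ B} ≤ M * P (Y ⁻¹' B) := by
  have := Measure.isProbabilityMeasure_map (μ := P) hX.aemeasurable
  have := Measure.isProbabilityMeasure_map (μ := P) hY.aemeasurable
  have hAB : MeasurableSet (A ∩ Prod.snd ⁻¹' B) := hA.inter (measurable_snd hB)
  calc P {ω | (X ω, Y ω) ∈ A ∧ Y ω ∈ B}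
      = P.map (fun ω ↦ (X ω, Y ω)) (A ∩ Prod.snd ⁻¹' B) := by
        rw [Measure.map_apply (hX.prodMk hY) hAB]
        rfl
    _ = ∫⁻ y, P.map X ((fun x ↦ (x, y)) ⁻¹' (A ∩ Prod.snd ⁻¹' B)) ∂P.map Y := by
        rw [hXY.map_prod_eq_prod_map_map hX.aemeasurable hY.aemeasurable,
          Measure.prod_apply_symm hAB]
    _ ≤ ∫⁻ y, B.indicator (fun _ ↦ M) y ∂P.map Y := by
        refine lintegral_mono fun y ↦ ?_
        by_cases hy : y ∈ B
        · rw [Set.indicator_of_mem hy]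
          exact (measure_mono fun x hx ↦ hx.1).trans (hM y)
        · have hempty : (fun x : E ↦ (x, y)) ⁻¹' (A ∩ Prod.snd ⁻¹' B) = ∅ :=
            Set.eq_empty_of_forall_notMem fun x hx ↦ hy hx.2
          simp [hempty]
    _ = M * P (Y ⁻¹' B) := by
        rw [lintegral_indicator_const hB, Measure.map_apply hY hB]

instance isProbabilityMeasure_gaussVec (n : ℕ) : IsProbabilityMeasure (gaussVec n) := by
  unfold gaussVec
  infer_instance

lemma iIndepFun_eval_gaussVec (n : ℕ) :
    iIndepFun (fun (i : Fin n) (v : Fin n → ℝ) ↦ v i) (gaussVec n) :=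
  iIndepFun_pi (X := fun _ ↦ id) fun _ ↦ aemeasurable_id

lemma map_sum_gaussVec (n : ℕ) (U : Finset (Fin n)) :
    (gaussVec n).map (fun v ↦ ∑ i ∈ U, v i) = gaussianReal 0 U.card := by
  induction U using Finset.induction_on with
  | empty => simp [gaussianReal_zero_var]
  | insert a U ha ih =>
    have hind := (iIndepFun_eval_gaussVec n).indepFun_finsetSum_of_notMem
      (fun i ↦ measurable_pi_apply i) ha
    have hsum : (∑ i ∈ U, fun v : Fin n → ℝ ↦ v i) = fun v ↦ ∑ i ∈ U, v i := by
      ext v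
      simp
    rw [hsum] at hind
    have heval : (gaussVec n).map (fun v ↦ v a) = gaussianReal 0 1 :=
      (measurePreserving_eval (fun _ : Fin n ↦ gaussianReal 0 1) a).map_eq
    have hadd := gaussianReal_add_gaussianReal_of_indepFun hind ih heval
    have hfun : (fun v : Fin n → ℝ ↦ ∑ i ∈ insert a U, v i) =
        (fun v ↦ ∑ i ∈ U, v i) + fun v ↦ v a := by
      ext v
      simp [Finset.sum_insert ha, add_comm]
    rw [hfun, hadd, Finset.card_insert_of_notMem ha]
    simp

/-- A partial sum of a standard Gaussian vector is independent of the coordinates outside it. -/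
lemma indepFun_sum_restrict_gaussVec (n : ℕ) {U W : Finset (Fin n)} (hUW : Disjoint U W) :
    IndepFun (fun v : Fin n → ℝ ↦ ∑ i ∈ U, v i) W.restrict (gaussVec n) := by
  have h := ((iIndepFun_eval_gaussVec n).indepFun_finset U W hUW
    fun i ↦ measurable_pi_apply i).comp (φ := fun x ↦ ∑ i, x i) (ψ := id)
    (by fun_prop) measurable_id
  convert h using 1
  · ext v
    exact (Finset.sum_coe_sort U v).symm
  · rfl

/-- for sets `S, T` of size `k` with `|S ∩ T| = βk`, `β ≤ 0.9`, a Gaussian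
vector balances both simultaneously with probability at most `(2/π)·d²/(k(1−β))`. -/
theorem joint_small_ball_upper_bound (n k : ℕ) (hk : 0 < k) (hkn : k ≤ n)
    (S T : Finset (Fin n)) (hS : S.card = k) (hT : T.card = k)
    (β : ℝ) (hβ0 : 0 ≤ β) (hβ1 : β ≤ 0.9) (hcap : ((S ∩ T).card : ℝ) = β * k)
    (d : ℝ) (hd : 0 < d) :
    gaussVec n {v | |∑ i ∈ S, v i| ≤ d ∧ |∑ i ∈ T, v i| ≤ d} ≤
      ENNReal.ofReal ((2 / Real.pi) * d ^ 2 / (k * (1 - β))) := by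
  have hkR : (0 : ℝ) < k := by exact_mod_cast hk
  have hk0 : ((k : ℕ) : ℝ≥0) ≠ 0 := by exact_mod_cast hk.ne'
  have hcard : (((S \ T).card : ℕ) : ℝ) = k * (1 - β) := by
    have h : (((S \ T).card + (S ∩ T).card : ℕ) : ℝ) = k := by
      rw [Finset.card_sdiff_add_card_inter, hS]
    push_cast at h
    linarith
  have hmpos : (0 : ℝ) < k * (1 - β) := mul_pos hkR (by linarith)
  have hm0 : (((S \ T).card : ℕ) : ℝ≥0) ≠ 0 := by
    have : (0 : ℝ) < ((S \ T).card : ℕ) := hcard ▸ hmpos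
    exact_mod_cast this.ne'
  have hindep := indepFun_sum_restrict_gaussVec n (Finset.sdiff_disjoint (s := T) (t := S))
  let C : (T → ℝ) → ℝ := fun y ↦ ∑ i : T, if (i : Fin n) ∈ S then y i else 0
  have hC : Measurable C := Finset.measurable_sum _ fun i _ ↦ by split_ifs <;> fun_prop
  have hCrestrict (v : Fin n → ℝ) : C (T.restrict v) = ∑ i ∈ S ∩ T, v i := by
    rw [Finset.inter_comm, ← Finset.filter_mem_eq_inter, Finset.sum_filter]
    exact Finset.sum_coe_sort T fun i ↦ if i ∈ S then v i else 0
  have hTrestrict (v : Fin n → ℝ) : ∑ i : T, T.restrict v i = ∑ i ∈ T, v i :=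
    Finset.sum_coe_sort T v
  have hcond := hindep.measure_prodMk_mem_and_mem_le (by fun_prop) (by fun_prop)
    (A := {p | |p.1 + C p.2| ≤ d}) (B := {y | |∑ i, y i| ≤ d})
    (measurableSet_le (by fun_prop) measurable_const)
    (measurableSet_le (by fun_prop) measurable_const) fun y ↦ by
      rw [map_sum_gaussVec]
      exact gaussianReal_setOf_abs_add_le 0 hm0 (C y) d
  have hT' : gaussVec n (T.restrict ⁻¹' {y | |∑ i, y i| ≤ d}) ≤
      ENNReal.ofReal ((√(2 * Real.pi * ((k : ℝ≥0) : ℝ)))⁻¹ * (2 * d)) := by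
    have h := gaussianReal_setOf_abs_add_le 0 hk0 0 d
    rw [← hT, ← map_sum_gaussVec, Measure.map_apply (by fun_prop)
      (measurableSet_le (by fun_prop) measurable_const)] at h
    simp only [add_zero] at h
    rw [← hT]
    convert h using 2
    ext v
    simp only [Set.mem_preimage, Set.mem_ofPred_eq, hTrestrict]
  have hset : {v : Fin n → ℝ | |∑ i ∈ S, v i| ≤ d ∧ |∑ i ∈ T, v i| ≤ d} =
      {v : Fin n → ℝ | (∑ i ∈ S \ T, v i, T.restrict v) ∈
        {p : ℝ × (T → ℝ) | |p.1 + C p.2| ≤ d} ∧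
        T.restrict v ∈ {y : T → ℝ | |∑ i, y i| ≤ d}} := by
    ext v
    simp only [Set.mem_ofPred_eq, hCrestrict, hTrestrict]
    rw [add_comm, Finset.sum_inter_add_sum_sdiff]
  rw [hset]
  refine (hcond.trans (mul_le_mul_right hT' _)).trans ?_
  rw [← ENNReal.ofReal_mul (by positivity)]
  refine ENNReal.ofReal_le_ofReal ?_
  simp only [NNReal.coe_natCast, hcard]
  set m : ℝ := k * (1 - β) with hm
  have hmk : m ≤ k := by nlinarith
  calc (√(2 * Real.pi * m))⁻¹ * (2 * d) * ((√(2 * Real.pi * k))⁻¹ * (2 * d))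
      ≤ (√(2 * Real.pi * m))⁻¹ * (2 * d) * ((√(2 * Real.pi * m))⁻¹ * (2 * d)) := by gcongr
    _ = (√(2 * Real.pi * m) ^ 2)⁻¹ * (2 * d) ^ 2 := by ring
    _ = 2 / Real.pi * d ^ 2 / m := by
        rw [Real.sq_sqrt (by positivity)]
        field_simp
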